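/- Let 1 ≤ d < n be integers, α₀ ∈ ℝ^{n−d}, A ∈ ℝ^{d×(n−d)}, Ã the (d+1)×(n−d) matrix with first row α₀ and remaining rows A, and H = {(x, (1,x)·Ã) : x ∈ ℝ^d} ⊆ ℝ^n. Let ν ≥ 1/n and suppose the multiplicative diophantine type satisfies ω(Ã) ≤ (d+1)/ν. Then the Hausdorff dimension of S_n(q ↦ q^{−ν}) ∩ H is at most d − (νn − 1)/(ν + 1). -/

import Mathlib

open MeasureTheory
open scoped ENNReal NNReal

/-- Distance to the nearest integer. -/
noncomputable def dNI (y : ℝ) : ℝ := |y - round y|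

/-- Supremum norm of an integer vector, as a natural number. -/
def jnorm {m : ℕ} (j : Fin m → ℤ) : ℕ := Finset.univ.sup fun i => (j i).natAbs

/-- The multiplicative diophantine type `ω(M)` of a matrix `M ∈ ℝ^{l×m}`:
the least upper bound of all `ω > 0` such that
`∏_{u=1}^l ‖j ⬝ row_u M‖ < |j|^{-ω}` has infinitely many solutions `j ∈ ℤ^m`. -/
noncomputable def multType {l m : ℕ} (M : Matrix (Fin l) (Fin m) ℝ) : ℝ≥0∞ :=
  sSup {w : ℝ≥0∞ | ∃ ω : ℝ, 0 < ω ∧ w = ENNReal.ofReal ω ∧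
    {j : Fin m → ℤ | j ≠ 0 ∧
      (∏ u, dNI (∑ v, (j v : ℝ) * M u v)) < (jnorm j : ℝ) ^ (-ω)}.Infinite}

section
open Finset

lemma dNI_nonneg (y : ℝ) : 0 ≤ dNI y := abs_nonneg _

lemma dNI_le_abs_sub (y : ℝ) (z : ℤ) : dNI y ≤ |y - z| := round_le y z

lemma dNI_le_half (y : ℝ) : dNI y ≤ 1 / 2 := abs_sub_round y

lemma dNI_sub_le (x y : ℝ) : dNI (x - y) ≤ |(x - round x) - (y - round y)| := by
  have h := dNI_le_abs_sub (x - y) (round x - round y)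
  push_cast at h
  rwa [show x - round x - (y - round y) = x - y - (round x - round y) by ring]

/-- The additive character `θ ↦ exp (2πiθ)`. -/
noncomputable def addExp (θ : ℝ) : ℂ := Complex.exp (Complex.I * ((2 * Real.pi * θ : ℝ) : ℂ))

lemma addExp_add (x y : ℝ) : addExp (x + y) = addExp x * addExp y := by
  simp only [addExp, ← Complex.exp_add]
  congr 1
  push_cast
  ring

lemma addExp_zero : addExp 0 = 1 := by simp [addExp]

lemma addExp_sum {ι : Type*} (s : Finset ι) (f : ι → ℝ) :
    addExp (∑ i ∈ s, f i) = ∏ i ∈ s, addExp (f i) := by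
  classical
  induction s using Finset.induction_on with
  | empty => simp [addExp_zero]
  | insert a s ha ih => rw [sum_insert ha, prod_insert ha, addExp_add, ih]

lemma norm_addExp (x : ℝ) : ‖addExp x‖ = 1 := by
  rw [addExp, mul_comm]
  exact Complex.norm_exp_ofReal_mul_I _

lemma conj_addExp (x : ℝ) : (starRingEnd ℂ) (addExp x) = addExp (-x) := by
  rw [addExp, addExp, ← Complex.exp_conj]
  congr 1
  simp only [map_mul, Complex.conj_I, Complex.conj_ofReal]
  push_cast
  ring

lemma addExp_nat_mul (k : ℕ) (x : ℝ) : addExp (k * x) = addExp x ^ k := by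
  rw [addExp, addExp, ← Complex.exp_nat_mul]
  congr 1
  push_cast
  ring

lemma addExp_int (z : ℤ) : addExp z = 1 := by
  rw [addExp, Complex.exp_eq_one_iff]
  exact ⟨z, by push_cast; ring⟩

lemma addExp_sub_round (x : ℝ) : addExp (x - round x) = addExp x := by
  conv_rhs => rw [← sub_add_cancel x (round x : ℝ), addExp_add, addExp_int, mul_one]

lemma four_mul_dNI_le (x : ℝ) : 4 * dNI x ≤ ‖addExp x - 1‖ := by
  rw [← addExp_sub_round, addExp, Complex.norm_exp_I_mul_ofReal_sub_one, Real.norm_eq_abs, abs_mul]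
  have h1 := abs_sub_round x
  have hpi := Real.pi_pos
  have h2 : |Real.pi * (x - round x)| ≤ Real.pi / 2 := by
    rw [abs_mul, abs_of_pos hpi]
    nlinarith
  have h3 := Real.mul_abs_le_abs_sin h2
  rw [abs_mul, abs_of_pos hpi] at h3
  have h4 : 2 / Real.pi * (Real.pi * |x - round x|) = 2 * dNI x := by
    rw [dNI]; field_simp
  rw [h4] at h3
  rw [show 2 * Real.pi * (x - round x) / 2 = Real.pi * (x - round x) by ring, abs_two]
  linarith

/-- A dyadic majorant of `min (2 ^ (K + 1)) (1 / dNI θ)`. -/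
noncomputable def dyadicMajorant (K : ℕ) (θ : ℝ) : ℝ :=
  ∑ k ∈ range (K + 1), if dNI θ ≤ (1 / 2) ^ k then (2 : ℝ) ^ (k + 1) else 0

lemma le_dyadicMajorant (K : ℕ) (θ S : ℝ) (h1 : S ≤ 2 ^ (K + 1)) (h2 : S * dNI θ ≤ 1) :
    S ≤ dyadicMajorant K θ := by
  induction K with
  | zero =>
    have h : dNI θ ≤ 1 := (dNI_le_half θ).trans (by norm_num)
    simpa [dyadicMajorant, h] using h1
  | succ K ih =>
    rw [dyadicMajorant, sum_range_succ]
    by_cases h : dNI θ ≤ (1 / 2) ^ (K + 1)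
    · rw [if_pos h]
      have : 0 ≤ ∑ k ∈ range (K + 1), if dNI θ ≤ (1 / 2) ^ k then (2 : ℝ) ^ (k + 1) else 0 :=
        sum_nonneg fun k _ => by split_ifs <;> positivity
      linarith
    · rw [if_neg h, add_zero]
      apply ih
      push Not at h
      by_contra! hS
      have h3 : (1 : ℝ) = 2 ^ (K + 1) * (1 / 2) ^ (K + 1) := by
        rw [← mul_pow]; norm_num
      have h4 : (2 : ℝ) ^ (K + 1) * (1 / 2) ^ (K + 1) < S * dNI θ :=
        mul_lt_mul'' hS h (by positivity) (by positivity)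
      linarith

lemma norm_sum_addExp_le (K : ℕ) (θ : ℝ) :
    ‖∑ i ∈ range (2 ^ K), addExp (i * θ)‖ ≤ dyadicMajorant K θ := by
  apply le_dyadicMajorant
  · refine (norm_sum_le _ _).trans ?_
    simp only [norm_addExp, sum_const, card_range, nsmul_eq_mul, mul_one]
    push_cast
    exact pow_le_pow_right₀ (by norm_num) (Nat.le_succ K)
  · simp only [addExp_nat_mul]
    have h := congrArg norm (geom_sum_mul (addExp θ) (2 ^ K))
    rw [norm_mul] at h
    have h1 : ‖addExp θ ^ 2 ^ K - 1‖ ≤ 2 := by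
      refine (norm_sub_le _ _).trans ?_
      rw [norm_pow, norm_addExp]
      norm_num
    have h2 := mul_le_mul_of_nonneg_left (four_mul_dNI_le θ)
      (norm_nonneg (∑ i ∈ range (2 ^ K), addExp θ ^ i))
    linarith

lemma half_le_norm_sum_addExp (H : ℕ) (θ : ℝ) (h : dNI θ * (6 * H) ≤ 1) :
    (H : ℝ) / 2 ≤ ‖∑ i ∈ range H, addExp (i * θ)‖ := by
  have h1 : ∀ i ∈ range H, (1 / 2 : ℝ) ≤ (addExp (i * θ)).re := by
    intro i hi
    have hi' : (i : ℝ) ≤ H := by exact_mod_cast (mem_range.1 hi).le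
    rw [addExp_nat_mul, ← addExp_sub_round, ← addExp_nat_mul, addExp, mul_comm Complex.I,
      Complex.exp_ofReal_mul_I_re, ← Real.cos_pi_div_three,
      ← Real.cos_abs (2 * Real.pi * _)]
    have hpi := Real.pi_pos
    apply Real.cos_le_cos_of_nonneg_of_le_pi (abs_nonneg _) (by linarith)
    rw [abs_mul, abs_mul, abs_mul, Nat.abs_cast, abs_two, abs_of_pos hpi]
    change 2 * Real.pi * (i * dNI θ) ≤ _
    have := mul_le_mul_of_nonneg_right hi' (dNI_nonneg θ)
    nlinarith
  calc (H : ℝ) / 2 = ∑ i ∈ range H, (1 / 2 : ℝ) := by simp; ring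
    _ ≤ ∑ i ∈ range H, (addExp (i * θ)).re := sum_le_sum h1
    _ = (∑ i ∈ range H, addExp (i * θ)).re := by simp
    _ ≤ _ := Complex.re_le_norm _

lemma dyadicMajorant_nonneg (K : ℕ) (θ : ℝ) : 0 ≤ dyadicMajorant K θ :=
  sum_nonneg fun k _ => by split_ifs <;> positivity

lemma card_mul_le_sum_dyadicMajorant {l m : ℕ} (M : Matrix (Fin l) (Fin m) ℝ) (β : Fin m → ℝ)
    (K H : ℕ) (T : Finset (Fin l → ℕ)) (hT : T ⊆ Fintype.piFinset fun _ => range (2 ^ K))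
    (hT' : ∀ i ∈ T, ∀ v, dNI (∑ u, (i u : ℝ) * M u v + β v) * (6 * H) ≤ 1) :
    (T.card : ℝ) * ((H : ℝ) / 2) ^ (2 * m) ≤
      ∑ h' ∈ Fintype.piFinset fun _ : Fin m => range H,
        ∑ h ∈ Fintype.piFinset fun _ : Fin m => range H,
          ∏ u, dyadicMajorant K (∑ v, ((h v : ℝ) - h' v) * M u v) := by
  set P := Fintype.piFinset fun _ : Fin m => range H with hP
  set Q := Fintype.piFinset fun _ : Fin l => range (2 ^ K) with hQ
  set y : (Fin l → ℕ) → Fin m → ℝ := fun i v => ∑ u, (i u : ℝ) * M u v + β v with hy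
  have key : ∀ i, ((∏ v, ‖∑ h ∈ range H, addExp (h * y i v)‖ ^ 2 : ℝ) : ℂ) =
      ∑ h' ∈ P, ∑ h ∈ P, addExp (∑ v, ((h v : ℝ) - h' v) * y i v) := by
    intro i
    rw [prod_pow, ← norm_prod, prod_univ_sum, ← hP]
    push_cast
    rw [← Complex.conj_mul', map_sum, sum_mul_sum]
    refine sum_congr rfl fun h' _ => sum_congr rfl fun h _ => ?_
    rw [← addExp_sum, ← addExp_sum, conj_addExp, ← addExp_add]
    congr 1
    rw [← sum_neg_distrib, ← sum_add_distrib]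
    exact sum_congr rfl fun v _ => by ring
  have inner : ∀ h h' : Fin m → ℕ, ‖∑ i ∈ Q, addExp (∑ v, ((h v : ℝ) - h' v) * y i v)‖ ≤
      ∏ u, dyadicMajorant K (∑ v, ((h v : ℝ) - h' v) * M u v) := by
    intro h h'
    have e : ∀ i : Fin l → ℕ, addExp (∑ v, ((h v : ℝ) - h' v) * y i v) =
        addExp (∑ v, ((h v : ℝ) - h' v) * β v) *
          ∏ u, addExp (i u * ∑ v, ((h v : ℝ) - h' v) * M u v) := by
      intro i
      rw [← addExp_sum, ← addExp_add]
      congr 1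
      simp only [hy, mul_add, sum_add_distrib, mul_sum]
      rw [add_comm, sum_comm]
      congr 1
      exact sum_congr rfl fun u _ => sum_congr rfl fun v _ => by ring
    simp_rw [e]
    rw [← mul_sum, norm_mul, norm_addExp, one_mul, hQ,
      ← prod_univ_sum (fun _ : Fin l => range (2 ^ K))
        (fun u (a : ℕ) => addExp (a * ∑ v, ((h v : ℝ) - h' v) * M u v)), norm_prod]
    exact prod_le_prod (fun _ _ => norm_nonneg _) fun u _ => norm_sum_addExp_le K _
  calc (T.card : ℝ) * ((H : ℝ) / 2) ^ (2 * m)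
      = ∑ i ∈ T, ∏ v : Fin m, ((H : ℝ) / 2) ^ 2 := by
        simp [pow_mul]
    _ ≤ ∑ i ∈ T, ∏ v, ‖∑ h ∈ range H, addExp (h * y i v)‖ ^ 2 := by
        refine sum_le_sum fun i hi => prod_le_prod (fun _ _ => by positivity) fun v _ => ?_
        exact pow_le_pow_left₀ (by positivity) (half_le_norm_sum_addExp H _ (hT' i hi v)) 2
    _ ≤ ∑ i ∈ Q, ∏ v, ‖∑ h ∈ range H, addExp (h * y i v)‖ ^ 2 :=
        sum_le_sum_of_subset_of_nonneg hT fun _ _ _ => prod_nonneg fun _ _ => by positivity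
    _ ≤ ‖((∑ i ∈ Q, ∏ v, ‖∑ h ∈ range H, addExp (h * y i v)‖ ^ 2 : ℝ) : ℂ)‖ := by
        rw [Complex.norm_real]; exact le_abs_self _
    _ = ‖∑ h' ∈ P, ∑ h ∈ P, ∑ i ∈ Q, addExp (∑ v, ((h v : ℝ) - h' v) * y i v)‖ := by
        rw [Complex.ofReal_sum, sum_congr rfl fun i _ => key i, sum_comm]
        congr 1
        exact sum_congr rfl fun h' _ => sum_comm
    _ ≤ _ := by
        refine (norm_sum_le _ _).trans (sum_le_sum fun h' _ => ?_)
        exact (norm_sum_le _ _).trans (sum_le_sum fun h _ => inner h h')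

lemma jnorm_le {m : ℕ} {j : Fin m → ℤ} {H : ℕ} (h : ∀ v, (j v).natAbs ≤ H) : jnorm j ≤ H :=
  Finset.sup_le fun v _ => h v

lemma jnorm_pos {m : ℕ} {j : Fin m → ℤ} (h : j ≠ 0) : 0 < jnorm j := by
  obtain ⟨v, hv⟩ := Function.ne_iff.1 h
  exact (Int.natAbs_pos.2 hv).trans_le
    (Finset.le_sup (f := fun i => (j i).natAbs) (mem_univ v))

/-- A Diophantine lower bound, valid for all nonzero `j`, extracted from a bound
on the multiplicative type. -/
lemma exists_pos_mul_rpow_le_prod_dNI {l m : ℕ} (M : Matrix (Fin l) (Fin m) ℝ) {w ω : ℝ}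
    (hw : 0 < w) (hM : multType M ≤ ENNReal.ofReal w) (hω : w < ω) :
    ∃ c : ℝ, 0 < c ∧ ∀ j : Fin m → ℤ, j ≠ 0 →
      c * (jnorm j : ℝ) ^ (-ω) ≤ ∏ u, dNI (∑ v, (j v : ℝ) * M u v) := by
  have hfin : {j : Fin m → ℤ | j ≠ 0 ∧
      (∏ u, dNI (∑ v, (j v : ℝ) * M u v)) < (jnorm j : ℝ) ^ (-ω)}.Finite := by
    by_contra hinf
    have h1 : ENNReal.ofReal ω ≤ multType M := le_sSup ⟨ω, hw.trans hω, rfl, hinf⟩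
    have h2 := h1.trans hM
    rw [ENNReal.ofReal_le_ofReal_iff hw.le] at h2
    linarith
  have hnonneg : ∀ j : Fin m → ℤ, 0 ≤ ∏ u, dNI (∑ v, (j v : ℝ) * M u v) :=
    fun j => prod_nonneg fun u _ => dNI_nonneg _
  have hpos : ∀ j : Fin m → ℤ, j ≠ 0 → 0 < ∏ u, dNI (∑ v, (j v : ℝ) * M u v) := by
    intro j hj
    refine lt_of_le_of_ne (hnonneg j) fun h0 => ?_
    obtain ⟨u, -, hu⟩ := prod_eq_zero_iff.1 h0.symm
    refine Set.infinite_of_injective_forall_mem (f := fun t : ℕ => ((t : ℤ) + 1) • j) ?_ ?_ hfin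
    · intro a b hab
      obtain ⟨v, hv⟩ := Function.ne_iff.1 hj
      have := congrFun hab v
      simp only [Pi.smul_apply, smul_eq_mul] at this
      have := mul_right_cancel₀ hv this
      omega
    · intro t
      have hne : ((t : ℤ) + 1) • j ≠ 0 := smul_ne_zero (by omega) hj
      refine ⟨hne, ?_⟩
      have hz : dNI (∑ v, (((((t : ℤ) + 1) • j) v : ℤ) : ℝ) * M u v) = 0 := by
        apply le_antisymm _ (dNI_nonneg _)
        refine (dNI_le_abs_sub _ (((t : ℤ) + 1) * round (∑ v, (j v : ℝ) * M u v))).trans ?_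
        have e : ∑ v, (((((t : ℤ) + 1) • j) v : ℤ) : ℝ) * M u v =
            ((t : ℝ) + 1) * ∑ v, (j v : ℝ) * M u v := by
          rw [mul_sum]
          refine sum_congr rfl fun v _ => ?_
          simp only [Pi.smul_apply, smul_eq_mul]
          push_cast
          ring
        rw [e]
        push_cast
        rw [← mul_sub, abs_mul]
        rw [dNI] at hu
        rw [hu, mul_zero]
      rw [prod_eq_zero (mem_univ u) hz]
      exact Real.rpow_pos_of_pos (by exact_mod_cast jnorm_pos hne) _
  obtain ⟨c, hc, hcle⟩ : ∃ c : ℝ, 0 < c ∧ ∀ j ∈ hfin.toFinset,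
      c ≤ ∏ u, dNI (∑ v, (j v : ℝ) * M u v) := by
    rcases hfin.toFinset.eq_empty_or_nonempty with h | h
    · exact ⟨1, one_pos, by simp [h]⟩
    · obtain ⟨j0, hj0, hmin⟩ := exists_min_image hfin.toFinset
        (fun j => ∏ u, dNI (∑ v, (j v : ℝ) * M u v)) h
      exact ⟨_, hpos j0 (hfin.mem_toFinset.1 hj0).1, hmin⟩
  refine ⟨min c 1, lt_min hc one_pos, fun j hj => ?_⟩
  have hJ : (1 : ℝ) ≤ jnorm j := by exact_mod_cast jnorm_pos hj
  have hJω : (jnorm j : ℝ) ^ (-ω) ≤ 1 := Real.rpow_le_one_of_one_le_of_nonpos hJ (by linarith)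
  have hJ0 : 0 ≤ (jnorm j : ℝ) ^ (-ω) := by positivity
  by_cases hjS : (∏ u, dNI (∑ v, (j v : ℝ) * M u v)) < (jnorm j : ℝ) ^ (-ω)
  · have := hcle j (hfin.mem_toFinset.2 ⟨hj, hjS⟩)
    have h3 : min c 1 * (jnorm j : ℝ) ^ (-ω) ≤ c * 1 :=
      mul_le_mul (min_le_left _ _) hJω hJ0 hc.le
    linarith
  · have h3 : min c 1 * (jnorm j : ℝ) ^ (-ω) ≤ 1 * (jnorm j : ℝ) ^ (-ω) :=
      mul_le_mul_of_nonneg_right (min_le_right _ _) hJ0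
    linarith

lemma card_filter_dNI_le {d m : ℕ} (M : Matrix (Fin (d + 1)) (Fin m) ℝ) {c ω : ℝ} (hω : 0 < ω)
    (hc : ∀ j : Fin m → ℤ, j ≠ 0 →
      c * (jnorm j : ℝ) ^ (-ω) ≤ ∏ u, dNI (∑ v, (j v : ℝ) * M u v)) (hc0 : 0 < c)
    {H : ℕ} (h' : Fin m → ℕ) (k : Fin (d + 1) → ℕ) {N : ℕ} (hN0 : 0 < N)
    (hN : 2 ^ (d + 1) * (∏ u, (1 / 2 : ℝ) ^ k u) * (H : ℝ) ^ ω / c < N) :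
    {h ∈ Fintype.piFinset fun _ : Fin m => range H |
      ∀ u, dNI (∑ v, ((h v : ℝ) - h' v) * M u v) ≤ (1 / 2) ^ k u}.card ≤ 2 * N + 1 := by
  set x : (Fin m → ℕ) → Fin (d + 1) → ℝ := fun h u => ∑ v, ((h v : ℝ) - h' v) * M u v with hx
  set t : (Fin m → ℕ) → Fin (d + 1) → ℝ := fun h u => x h u - round (x h u) with ht
  have hN0' : (0 : ℝ) < N := by exact_mod_cast hN0
  have hcard : (Finset.Icc (-(N : ℤ)) N).card = 2 * N + 1 := by
    rw [Int.card_Icc]; omega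
  rw [← hcard]
  refine card_le_card_of_injOn (fun h => ⌊t h 0 * (N * 2 ^ k 0)⌋) ?_ ?_
  · intro h hh
    rw [mem_coe, mem_filter] at hh
    have h1 : |t h 0| ≤ (1 / 2) ^ k 0 := hh.2 0
    have h2 : (1 / 2 : ℝ) ^ k 0 * (N * 2 ^ k 0) = N := by
      rw [mul_left_comm, ← mul_pow]; norm_num
    have h3 : |t h 0 * (N * 2 ^ k 0)| ≤ N := by
      rw [abs_mul, abs_of_pos (by positivity : (0 : ℝ) < N * 2 ^ k 0)]
      exact (mul_le_mul_of_nonneg_right h1 (by positivity)).trans_eq h2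
    rw [abs_le] at h3
    rw [mem_coe, Finset.mem_Icc]
    constructor
    · rw [Int.le_floor]; push_cast; exact h3.1
    · have := (Int.floor_le (t h 0 * (N * 2 ^ k 0))).trans h3.2
      exact_mod_cast this
  · intro h hh g hg hfl
    rw [mem_coe, mem_filter, Fintype.mem_piFinset] at hh hg
    by_contra hne
    have hj : (fun v => (h v : ℤ) - g v) ≠ 0 := by
      intro h0
      apply hne
      funext v
      have := congrFun h0 v
      simp only [Pi.zero_apply] at this
      omega
    have hlow := hc _ hj
    have e : ∀ u, ∑ v, (((h v : ℤ) - g v : ℤ) : ℝ) * M u v = x h u - x g u := by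
      intro u
      rw [hx, ← sum_sub_distrib]
      refine sum_congr rfl fun v _ => ?_
      push_cast
      ring
    simp only [e] at hlow
    have hH : jnorm (fun v => (h v : ℤ) - g v) ≤ H := by
      refine jnorm_le fun v => ?_
      have h1 := mem_range.1 (hh.1 v)
      have h2 := mem_range.1 (hg.1 v)
      omega
    have hup : ∏ u, dNI (x h u - x g u) ≤
        ∏ u, ((2 * (1 / 2 : ℝ) ^ k u) * if u = 0 then 1 / (N : ℝ) else 1) := by
      refine prod_le_prod (fun u _ => dNI_nonneg _) fun u _ => ?_
      refine (dNI_sub_le _ _).trans ?_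
      change |t h u - t g u| ≤ _
      split_ifs with hu
      · subst hu
        have h1 := Int.abs_sub_lt_one_of_floor_eq_floor hfl
        rw [← sub_mul, abs_mul, abs_of_pos (by positivity : (0 : ℝ) < N * 2 ^ k 0)] at h1
        have h2 : |t h 0 - t g 0| ≤ 1 / (N * 2 ^ k 0) := by
          rw [le_div_iff₀ (by positivity)]; exact h1.le
        refine h2.trans ?_
        have h3 : (1 : ℝ) / (N * 2 ^ k 0) = (1 / 2) ^ k 0 * (1 / N) := by
          rw [div_pow, one_pow]; field_simp
        rw [h3]
        have : (0 : ℝ) ≤ (1 / 2) ^ k 0 * (1 / N) := by positivity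
        linarith
      · have h1 : |t h u| ≤ (1 / 2) ^ k u := hh.2 u
        have h2 : |t g u| ≤ (1 / 2) ^ k u := hg.2 u
        have := abs_sub (t h u) (t g u)
        linarith
    rw [prod_mul_distrib, prod_mul_distrib, prod_ite_eq' univ (0 : Fin (d + 1))] at hup
    simp only [mem_univ, if_true, prod_const, card_univ, Fintype.card_fin] at hup
    have hJ0 : (0 : ℝ) < jnorm (fun v => (h v : ℤ) - g v) := by exact_mod_cast jnorm_pos hj
    have hH' : (jnorm (fun v => (h v : ℤ) - g v) : ℝ) ≤ H := by exact_mod_cast hH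
    have hHpos : (0 : ℝ) < H := hJ0.trans_le hH'
    have hmono : c * (H : ℝ) ^ (-ω) ≤ c * (jnorm (fun v => (h v : ℤ) - g v) : ℝ) ^ (-ω) :=
      mul_le_mul_of_nonneg_left
        (Real.rpow_le_rpow_of_nonpos hJ0 hH' (by linarith)) hc0.le
    have hfinal := (hmono.trans hlow).trans hup
    rw [Real.rpow_neg hHpos.le] at hfinal
    have hHω : 0 < (H : ℝ) ^ ω := Real.rpow_pos_of_pos hHpos _
    rw [div_lt_iff₀ hc0] at hN
    rw [mul_one_div, le_div_iff₀ hN0', ← div_eq_mul_inv, div_mul_eq_mul_div, div_le_iff₀ hHω]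
      at hfinal
    linarith

lemma sum_prod_dyadicMajorant_le {d m : ℕ} (M : Matrix (Fin (d + 1)) (Fin m) ℝ) {c ω : ℝ}
    (hω : 0 < ω)
    (hc : ∀ j : Fin m → ℤ, j ≠ 0 →
      c * (jnorm j : ℝ) ^ (-ω) ≤ ∏ u, dNI (∑ v, (j v : ℝ) * M u v)) (hc0 : 0 < c)
    (K H : ℕ) (h' : Fin m → ℕ) :
    ∑ h ∈ Fintype.piFinset fun _ : Fin m => range H,
        ∏ u, dyadicMajorant K (∑ v, ((h v : ℝ) - h' v) * M u v) ≤
      (K + 1) ^ (d + 1) * (2 ^ (d + 1) *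
        (2 * (2 ^ (d + 1) * (H : ℝ) ^ ω / c) + 3 * 2 ^ (K * (d + 1)))) := by
  have hexp : ∀ h : Fin m → ℕ, ∏ u, dyadicMajorant K (∑ v, ((h v : ℝ) - h' v) * M u v) =
      ∑ k ∈ Fintype.piFinset fun _ : Fin (d + 1) => range (K + 1),
        if ∀ u, dNI (∑ v, ((h v : ℝ) - h' v) * M u v) ≤ (1 / 2) ^ k u then
          ∏ u, (2 : ℝ) ^ (k u + 1) else 0 := by
    intro h
    simp only [dyadicMajorant]
    rw [prod_univ_sum]
    refine sum_congr rfl fun k _ => ?_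
    rw [prod_ite_zero]
    simp only [mem_univ, true_imp_iff]
  rw [sum_congr rfl fun h _ => hexp h, sum_comm]
  have hcard : ((Fintype.piFinset fun _ : Fin (d + 1) => range (K + 1)).card : ℝ) =
      (K + 1) ^ (d + 1) := by
    simp
  rw [← hcard, ← nsmul_eq_mul]
  refine sum_le_card_nsmul _ _ _ fun k hk => ?_
  rw [← sum_filter, sum_const, nsmul_eq_mul]
  set V : ℝ := ∏ u, (1 / 2 : ℝ) ^ k u with hV
  set A : ℝ := 2 ^ (d + 1) * V * (H : ℝ) ^ ω / c with hA
  have hV0 : 0 < V := prod_pos fun u _ => by positivity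
  have hA0 : 0 ≤ A := by positivity
  have h1 := card_filter_dNI_le M hω hc hc0 (H := H) h' k (N := ⌊A⌋₊ + 1) (Nat.succ_pos _)
    (by push_cast; exact Nat.lt_floor_add_one A)
  have h2 : (({h ∈ Fintype.piFinset fun _ : Fin m => range H |
      ∀ u, dNI (∑ v, ((h v : ℝ) - h' v) * M u v) ≤ (1 / 2) ^ k u}.card : ℕ) : ℝ) ≤
      2 * A + 3 := by
    have h3 := Nat.floor_le hA0
    have h4 : (({h ∈ Fintype.piFinset fun _ : Fin m => range H |
      ∀ u, dNI (∑ v, ((h v : ℝ) - h' v) * M u v) ≤ (1 / 2) ^ k u}.card : ℕ) : ℝ) ≤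
      2 * (⌊A⌋₊ + 1) + 1 := by exact_mod_cast h1
    linarith
  set W : ℝ := ∏ u, (2 : ℝ) ^ k u with hW
  have hW0 : 0 < W := prod_pos fun u _ => by positivity
  have hprod : ∏ u, (2 : ℝ) ^ (k u + 1) = 2 ^ (d + 1) * W := by
    simp_rw [pow_succ', prod_mul_distrib]
    simp [hW, pow_succ']
  have hVW : V * W = 1 := by
    rw [hV, hW, ← prod_mul_distrib]
    refine prod_eq_one fun u _ => ?_
    rw [← mul_pow]; norm_num
  have hWle : W ≤ 2 ^ (K * (d + 1)) := by
    have : W ≤ ∏ _u : Fin (d + 1), (2 : ℝ) ^ K := by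
      refine prod_le_prod (fun u _ => by positivity) fun u _ => ?_
      have := mem_range.1 (Fintype.mem_piFinset.1 hk u)
      exact pow_le_pow_right₀ (by norm_num) (by omega)
    simpa [pow_mul] using this
  rw [hprod]
  calc _ ≤ (2 * A + 3) * (2 ^ (d + 1) * W) :=
        mul_le_mul_of_nonneg_right h2 (by positivity)
    _ = 2 ^ (d + 1) * (2 * (2 ^ (d + 1) * (H : ℝ) ^ ω / c) * (V * W) + 3 * W) := by
        rw [hA]; ring
    _ ≤ _ := by
        rw [hVW, mul_one]
        gcongr

lemma exists_card_mul_pow_le {d m : ℕ} (M : Matrix (Fin (d + 1)) (Fin m) ℝ) {w ω : ℝ}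
    (hw : 0 < w) (hM : multType M ≤ ENNReal.ofReal w) (hω : w < ω) :
    ∃ C : ℝ, 0 < C ∧ ∀ (β : Fin m → ℝ) (K H : ℕ), 0 < H → ∀ T : Finset (Fin (d + 1) → ℕ),
      (T ⊆ Fintype.piFinset fun _ => range (2 ^ K)) →
      (∀ i ∈ T, ∀ v, dNI (∑ u, (i u : ℝ) * M u v + β v) * (6 * H) ≤ 1) →
      (T.card : ℝ) * (H : ℝ) ^ m ≤
        C * (K + 1) ^ (d + 1) * ((H : ℝ) ^ ω + 2 ^ (K * (d + 1))) := by
  obtain ⟨c, hc0, hc⟩ := exists_pos_mul_rpow_le_prod_dNI M hw hM hω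
  refine ⟨4 ^ m * (2 ^ (d + 1) * (2 * (2 ^ (d + 1) / c) + 3)), by positivity, ?_⟩
  intro β K H hH T hT hT'
  have hH' : (0 : ℝ) < H := by exact_mod_cast hH
  have h1 := card_mul_le_sum_dyadicMajorant M β K H T hT hT'
  have h2 := h1.trans (sum_le_card_nsmul _ _ _ fun h' _ =>
    sum_prod_dyadicMajorant_le M (hw.trans hω) hc hc0 K H h')
  rw [nsmul_eq_mul, Fintype.card_piFinset] at h2
  simp only [card_range, prod_const, card_univ, Fintype.card_fin, Nat.cast_pow] at h2
  have h3 : ((H : ℝ) / 2) ^ (2 * m) = (H : ℝ) ^ m * (H : ℝ) ^ m / 4 ^ m := by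
    rw [div_pow, pow_mul 2 2 m, two_mul, pow_add]; norm_num
  rw [h3] at h2
  have hHm : (0 : ℝ) < (H : ℝ) ^ m := by positivity
  have h4 : (T.card : ℝ) * (H : ℝ) ^ m ≤ 4 ^ m * ((K + 1) ^ (d + 1) * (2 ^ (d + 1) *
        (2 * (2 ^ (d + 1) * (H : ℝ) ^ ω / c) + 3 * 2 ^ (K * (d + 1))))) := by
    rw [← mul_le_mul_iff_of_pos_left hHm]
    have h5 : (4 : ℝ) ^ m * (T.card * (H ^ m * H ^ m / 4 ^ m)) = H ^ m * (T.card * H ^ m) := by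
      field_simp
    rw [← h5]
    have := mul_le_mul_of_nonneg_left h2 (by positivity : (0 : ℝ) ≤ 4 ^ m)
    linarith
  refine h4.trans ?_
  have hX : 0 ≤ (H : ℝ) ^ ω := by positivity
  have hY : (0 : ℝ) ≤ 2 ^ (K * (d + 1)) := by positivity
  have h6 : 2 * (2 ^ (d + 1) * (H : ℝ) ^ ω / c) + 3 * 2 ^ (K * (d + 1)) ≤
      (2 * (2 ^ (d + 1) / c) + 3) * ((H : ℝ) ^ ω + 2 ^ (K * (d + 1))) := by
    have h7 : (0 : ℝ) ≤ 2 ^ (d + 1) / c * 2 ^ (K * (d + 1)) := by positivity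
    have h8 : 2 ^ (d + 1) * (H : ℝ) ^ ω / c = 2 ^ (d + 1) / c * (H : ℝ) ^ ω := by ring
    rw [h8]
    nlinarith
  calc _ ≤ 4 ^ m * ((K + 1 : ℝ) ^ (d + 1) * (2 ^ (d + 1) *
        ((2 * (2 ^ (d + 1) / c) + 3) * ((H : ℝ) ^ ω + 2 ^ (K * (d + 1)))))) := by gcongr
    _ = _ := by ring

/-- The parameters `x` for which the point of the affine subspace above `x` admits infinitely many
rational approximations `q` of order `q ^ (-ν)`. -/
def approxParams {d m : ℕ} (M : Matrix (Fin (d + 1)) (Fin m) ℝ) (ν : ℝ) : Set (Fin d → ℝ) :=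
  {x | {q : ℕ | 0 < q ∧ (∀ i, dNI ((q : ℝ) * x i) < (q : ℝ) ^ (-ν)) ∧
    (∀ v, dNI ((q : ℝ) * ∑ u, (Fin.cons (1 : ℝ) x : Fin (d + 1) → ℝ) u * M u v) <
      (q : ℝ) ^ (-ν))}.Infinite}

/-- Shifted integer vectors `(q, p + 2 ^ (k + B + 1))` with `q ≥ 2 ^ k` for which `(q, p) M` is
within `1 / (6 H)` of an integer vector. -/
noncomputable def nearIntegral {d m : ℕ} (M : Matrix (Fin (d + 1)) (Fin m) ℝ) (B k H : ℕ) :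
    Finset (Fin (d + 1) → ℕ) :=
  {i ∈ Fintype.piFinset fun _ => range (2 ^ (k + B + 2)) | 2 ^ k ≤ i 0 ∧
    ∀ v, dNI (∑ u, (i u : ℝ) * M u v + -∑ u : Fin d, 2 ^ (k + B + 1) * M u.succ v) * (6 * H) ≤ 1}

/-- The rational point encoded by an element of `nearIntegral`. -/
noncomputable def rationalCenter {d : ℕ} (B k : ℕ) (i : Fin (d + 1) → ℕ) : Fin d → ℝ :=
  fun u => ((i u.succ : ℝ) - 2 ^ (k + B + 1)) / i 0

/-- A bound for the coefficients of an affine parametrization. -/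
noncomputable def coeffBound {d m : ℕ} (M : Matrix (Fin (d + 1)) (Fin m) ℝ) : ℝ :=
  1 + ∑ v, ∑ u : Fin d, |M u.succ v|

lemma one_le_coeffBound {d m : ℕ} (M : Matrix (Fin (d + 1)) (Fin m) ℝ) : 1 ≤ coeffBound M :=
  le_add_of_nonneg_right (sum_nonneg fun _ _ => sum_nonneg fun _ _ => abs_nonneg _)

lemma exists_mem_nearIntegral {d m : ℕ} (M : Matrix (Fin (d + 1)) (Fin m) ℝ) {ν : ℝ} (hν : 0 < ν)
    {B k H q : ℕ} (hH : 6 * H * coeffBound M ≤ ((2 : ℝ) ^ ν) ^ k) {x : Fin d → ℝ}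
    (hx : ∀ u, |x u| ≤ B) (hq1 : 2 ^ k ≤ q) (hq2 : q < 2 ^ (k + 1))
    (h1 : ∀ i, dNI ((q : ℝ) * x i) < (q : ℝ) ^ (-ν))
    (h2 : ∀ v, dNI ((q : ℝ) * ∑ u, (Fin.cons (1 : ℝ) x : Fin (d + 1) → ℝ) u * M u v) <
      (q : ℝ) ^ (-ν)) :
    ∃ i ∈ nearIntegral M B k H,
      x ∈ Metric.closedBall (rationalCenter B k i) (((2 : ℝ) ^ ν * 2)⁻¹ ^ k) := by
  have ha : (0 : ℝ) < 2 ^ ν := by positivity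
  have hq0 : 0 < q := (Nat.two_pow_pos k).trans_le hq1
  have hq0' : (0 : ℝ) < q := by exact_mod_cast hq0
  have hq_lower : (2 : ℝ) ^ k ≤ q := by exact_mod_cast hq1
  have hq_upper : (q : ℝ) ≤ 2 ^ (k + 1) := by exact_mod_cast hq2.le
  have hqν : (q : ℝ) ^ (-ν) ≤ (((2 : ℝ) ^ ν) ^ k)⁻¹ := by
    have h := Real.rpow_le_rpow_of_nonpos (by positivity) hq_lower (by linarith : -ν ≤ 0)
    refine h.trans_eq ?_
    rw [Real.rpow_neg (by positivity), ← Real.rpow_natCast_mul (by norm_num), mul_comm (k : ℝ) ν,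
      Real.rpow_mul_natCast (by norm_num)]
  set δ : ℝ := (((2 : ℝ) ^ ν) ^ k)⁻¹ with hδ
  have hδ0 : 0 < δ := by positivity
  set p : Fin d → ℤ := fun u => round ((q : ℝ) * x u) with hp
  have hpx : ∀ u, |(q : ℝ) * x u - p u| ≤ δ := fun u => (h1 u).le.trans hqν
  have hpb : ∀ u, |(p u : ℝ)| < 2 ^ (k + B + 1) := by
    intro u
    have e1 : |(q : ℝ) * x u| ≤ 2 ^ (k + 1) * B := by
      rw [abs_mul, Nat.abs_cast]
      exact mul_le_mul hq_upper (hx u) (abs_nonneg _) (by positivity)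
    have e2 : |(q : ℝ) * x u - p u| ≤ 1 / 2 := abs_sub_round _
    have e3 : (B : ℝ) + 1 ≤ 2 ^ B := by exact_mod_cast Nat.lt_two_pow_self
    have e4 : (2 : ℝ) ^ (k + B + 1) = 2 ^ (k + 1) * 2 ^ B := by ring
    have e5 : (1 : ℝ) ≤ 2 ^ (k + 1) := one_le_pow₀ (by norm_num)
    have e6 := abs_sub_abs_le_abs_sub (p u : ℝ) (q * x u)
    rw [abs_sub_comm] at e6
    rw [e4]
    nlinarith
  set i : Fin (d + 1) → ℕ := Fin.cons q fun u => (p u + 2 ^ (k + B + 1)).toNat with hi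
  have hi0 : i 0 = q := rfl
  have hiZ : ∀ u : Fin d, ((i u.succ : ℕ) : ℤ) = p u + 2 ^ (k + B + 1) := by
    intro u
    have := (abs_lt.1 (hpb u)).1
    have h3 : -2 ^ (k + B + 1) < p u := by exact_mod_cast this
    exact Int.toNat_of_nonneg (by linarith)
  have hiR : ∀ u : Fin d, (i u.succ : ℝ) = p u + 2 ^ (k + B + 1) := by
    intro u
    exact_mod_cast congrArg (Int.cast : ℤ → ℝ) (hiZ u)
  refine ⟨i, ?_, ?_⟩
  · rw [nearIntegral, mem_filter, Fintype.mem_piFinset]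
    refine ⟨fun u => ?_, hq1, fun v => ?_⟩
    · rw [mem_range]
      refine Fin.cases ?_ (fun u => ?_) u
      · rw [hi0]
        exact hq2.trans_le (Nat.pow_le_pow_right (by norm_num) (by omega))
      · have := (abs_lt.1 (hpb u)).2
        have h3 : p u < 2 ^ (k + B + 1) := by exact_mod_cast this
        have h4 := hiZ u
        have h5 : (2 : ℤ) ^ (k + B + 2) = 2 * 2 ^ (k + B + 1) := by ring
        have h6 : ((i u.succ : ℕ) : ℤ) < 2 ^ (k + B + 2) := by rw [h4, h5]; linarith
        exact_mod_cast h6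
    · set y : ℝ := (q : ℝ) * ∑ u, (Fin.cons (1 : ℝ) x : Fin (d + 1) → ℝ) u * M u v with hy
      set z : ℝ := ∑ u, (i u : ℝ) * M u v + -∑ u : Fin d, 2 ^ (k + B + 1) * M u.succ v with hz
      have hzy : y - z = ∑ u : Fin d, ((q : ℝ) * x u - p u) * M u.succ v := by
        rw [hy, hz, Fin.sum_univ_succ, Fin.sum_univ_succ, hi0]
        simp only [Fin.cons_zero, Fin.cons_succ, hiR, add_mul, sub_mul, sum_add_distrib,
          sum_sub_distrib, mul_add, mul_sum, mul_assoc]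
        ring
      have hyz : |y - z| ≤ δ * ∑ u : Fin d, |M u.succ v| := by
        rw [hzy, mul_sum]
        refine (abs_sum_le_sum_abs _ _).trans (sum_le_sum fun u _ => ?_)
        rw [abs_mul]
        exact mul_le_mul_of_nonneg_right (hpx u) (abs_nonneg _)
      have hsum : ∑ u : Fin d, |M u.succ v| ≤ ∑ v, ∑ u : Fin d, |M u.succ v| :=
        single_le_sum (f := fun v => ∑ u : Fin d, |M u.succ v|)
          (fun _ _ => sum_nonneg fun _ _ => abs_nonneg _) (mem_univ v)
      have hyd : |y - round y| ≤ δ := (h2 v).le.trans hqν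
      have hzd : dNI z ≤ δ * coeffBound M := by
        refine (dNI_le_abs_sub z (round y)).trans ?_
        have e1 := abs_sub_le z y (round y)
        rw [abs_sub_comm z y] at e1
        have e2 := mul_le_mul_of_nonneg_left hsum hδ0.le
        rw [coeffBound, mul_add, mul_one]
        linarith
      calc dNI z * (6 * H) ≤ δ * coeffBound M * (6 * H) :=
            mul_le_mul_of_nonneg_right hzd (by positivity)
        _ = δ * (6 * H * coeffBound M) := by ring
        _ ≤ δ * ((2 : ℝ) ^ ν) ^ k := mul_le_mul_of_nonneg_left hH hδ0.le
        _ = 1 := inv_mul_cancel₀ (by positivity)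
  · rw [Metric.mem_closedBall, dist_pi_le_iff (by positivity)]
    intro u
    rw [Real.dist_eq, rationalCenter, hi0, hiR, add_sub_cancel_right]
    have e1 : x u - p u / q = (q * x u - p u) / q := by field_simp
    rw [e1, abs_div, abs_of_pos hq0', mul_inv, mul_pow, inv_pow, inv_pow, ← div_eq_mul_inv]
    exact div_le_div₀ hδ0.le (hpx u) (pow_pos two_pos k) hq_lower

/-- The scale `H` matched to denominators of size `2 ^ k`. -/
noncomputable def fejerScale {d m : ℕ} (M : Matrix (Fin (d + 1)) (Fin m) ℝ) (ν : ℝ) (k : ℕ) : ℕ :=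
  ⌊((2 : ℝ) ^ ν) ^ k / (6 * coeffBound M)⌋₊

lemma summable_succ_pow_mul_geometric (l : ℕ) {θ : ℝ} (hθ0 : 0 < θ) (hθ1 : θ < 1) :
    Summable fun k : ℕ => ((k : ℝ) + 1) ^ l * θ ^ k := by
  have h0 : Summable fun k : ℕ => (k : ℝ) ^ l * θ ^ k :=
    summable_pow_mul_geometric_of_norm_lt_one l (by rwa [Real.norm_of_nonneg hθ0.le])
  have h := (summable_nat_add_iff 1).2 h0
  refine (h.mul_left θ⁻¹).congr fun k => ?_
  push_cast
  rw [pow_succ θ k]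
  field_simp

lemma summable_card_nearIntegral {d m : ℕ} (M : Matrix (Fin (d + 1)) (Fin m) ℝ) {ν s : ℝ}
    (hν : 0 < ν) (hM : multType M ≤ ENNReal.ofReal (((d : ℝ) + 1) / ν))
    (hs : (d : ℝ) + 1 - ν * m < (ν + 1) * s) (B : ℕ) :
    Summable fun k : ℕ => ((nearIntegral M B k (fejerScale M ν k)).card : ℝ) *
      (2 * ((2 : ℝ) ^ ν * 2)⁻¹ ^ k) ^ s := by
  set ε : ℝ := ((ν + 1) * s - (d + 1 - ν * m)) / 2 with hε
  have hε0 : 0 < ε := by rw [hε]; linarith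
  set ω : ℝ := (d + 1 + ε) / ν with hω
  have hνω : ν * ω = d + 1 + ε := by rw [hω]; field_simp
  have hω0 : 0 < ω := by positivity
  obtain ⟨C, hC0, hC⟩ := exists_card_mul_pow_le M (w := ((d : ℝ) + 1) / ν) (ω := ω)
    (by positivity) hM (div_lt_div_of_pos_right (by linarith) hν)
  set a : ℝ := (2 : ℝ) ^ ν with ha
  have ha0 : 0 < a := by positivity
  have ha1 : 1 < a := Real.one_lt_rpow (by norm_num) hν
  set c₁ : ℝ := coeffBound M with hc₁
  have hc₁1 : 1 ≤ c₁ := one_le_coeffBound M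
  set ρ : ℝ := (a * 2)⁻¹ with hρ
  have hρ0 : 0 < ρ := by positivity
  set θ : ℝ := a ^ ω / a ^ m * ρ ^ s with hθ
  have hθ0 : 0 < θ := by positivity
  have hθ1 : θ < 1 := by
    have e : θ = 2 ^ (-ε) := by
      have e1 : a * 2 = 2 ^ (ν + 1) := by rw [Real.rpow_add_one (by norm_num)]
      rw [hθ, hρ, e1, ha, ← Real.rpow_neg (by norm_num), ← Real.rpow_mul (by norm_num),
        ← Real.rpow_mul (by norm_num), ← Real.rpow_mul_natCast (by norm_num),
        ← Real.rpow_sub (by norm_num), ← Real.rpow_add (by norm_num), hνω]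
      congr 1
      rw [hε]; ring
    rw [e]
    exact Real.rpow_lt_one_of_one_lt_of_neg (by norm_num) (by linarith)
  have ha_ω : (2 : ℝ) ^ (d + 1) ≤ a ^ ω := by
    rw [ha, ← Real.rpow_mul (by norm_num), hνω, ← Real.rpow_natCast]
    apply Real.rpow_le_rpow_of_exponent_le (by norm_num)
    push_cast; linarith
  set D : ℝ := C * (B + 3) ^ (d + 1) * (1 + 2 ^ ((B + 2) * (d + 1))) * (12 * c₁) ^ m * 2 ^ s with hD
  have hsum : Summable fun k : ℕ => D * (((k : ℝ) + 1) ^ (d + 1) * θ ^ k) :=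
    (summable_succ_pow_mul_geometric (d + 1) hθ0 hθ1).mul_left D
  refine hsum.of_norm_bounded_eventually_nat ?_
  have hev : ∀ᶠ k : ℕ in Filter.atTop, 6 * c₁ ≤ a ^ k :=
    (tendsto_pow_atTop_atTop_of_one_lt ha1).eventually_ge_atTop _
  filter_upwards [hev] with k hk
  rw [Real.norm_of_nonneg (by positivity)]
  set H := fejerScale M ν k with hH
  have hHle : (H : ℝ) ≤ a ^ k / (6 * c₁) := Nat.floor_le (by positivity)
  have hr1 : 1 ≤ a ^ k / (6 * c₁) := by rwa [le_div_iff₀ (by positivity), one_mul]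
  have hHpos : 0 < H := Nat.floor_pos.2 hr1
  have hHpos' : (1 : ℝ) ≤ H := by exact_mod_cast hHpos
  have hHge : a ^ k / (12 * c₁) ≤ H := by
    have h1 : a ^ k / (6 * c₁) < H + 1 := Nat.lt_floor_add_one _
    have h2 : a ^ k / (12 * c₁) = a ^ k / (6 * c₁) / 2 := by rw [div_div]; ring
    linarith
  have hHak : (H : ℝ) ≤ a ^ k := hHle.trans (div_le_self (by positivity) (by linarith))
  have hHω : (H : ℝ) ^ ω ≤ (a ^ ω) ^ k := by
    refine (Real.rpow_le_rpow (by positivity) hHak hω0.le).trans_eq ?_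
    rw [← Real.rpow_natCast_mul ha0.le, mul_comm, Real.rpow_mul_natCast ha0.le]
  have hcard := hC (fun v => -∑ u : Fin d, 2 ^ (k + B + 1) * M u.succ v) (k + B + 2) H hHpos
    (nearIntegral M B k H) (filter_subset _ _) (fun i hi => (mem_filter.1 hi).2.2)
  set N : ℝ := ((nearIntegral M B k H).card : ℝ) with hN
  have hpow : (2 : ℝ) ^ ((k + B + 2) * (d + 1)) ≤ 2 ^ ((B + 2) * (d + 1)) * (a ^ ω) ^ k := by
    have : (2 : ℝ) ^ ((k + B + 2) * (d + 1)) =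
        2 ^ ((B + 2) * (d + 1)) * (2 ^ (d + 1)) ^ k := by ring
    rw [this]
    gcongr
  have hlin : ((k + B + 2 : ℕ) : ℝ) + 1 ≤ (B + 3) * (k + 1) := by
    push_cast
    nlinarith [(Nat.cast_nonneg k : (0 : ℝ) ≤ k), (Nat.cast_nonneg B : (0 : ℝ) ≤ B),
      mul_nonneg (Nat.cast_nonneg k : (0 : ℝ) ≤ k) (Nat.cast_nonneg B : (0 : ℝ) ≤ B)]
  have hNbound : N * (a ^ k / (12 * c₁)) ^ m ≤ C * ((B + 3) * (k + 1)) ^ (d + 1) *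
      ((a ^ ω) ^ k + 2 ^ ((B + 2) * (d + 1)) * (a ^ ω) ^ k) := by
    calc N * (a ^ k / (12 * c₁)) ^ m ≤ N * (H : ℝ) ^ m := by gcongr
      _ ≤ _ := hcard
      _ ≤ _ := by gcongr
  have hρs : (2 * ρ ^ k) ^ s = 2 ^ s * (ρ ^ s) ^ k := by
    rw [Real.mul_rpow (by norm_num) (by positivity), ← Real.rpow_natCast_mul hρ0.le, mul_comm _ s,
      Real.rpow_mul_natCast hρ0.le]
  have hN2 : N ≤ C * ((B + 3) * (k + 1)) ^ (d + 1) *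
      ((a ^ ω) ^ k + 2 ^ ((B + 2) * (d + 1)) * (a ^ ω) ^ k) / (a ^ k / (12 * c₁)) ^ m := by
    rwa [le_div_iff₀ (by positivity)]
  calc N * (2 * ρ ^ k) ^ s ≤ C * ((B + 3) * (k + 1)) ^ (d + 1) *
      ((a ^ ω) ^ k + 2 ^ ((B + 2) * (d + 1)) * (a ^ ω) ^ k) / (a ^ k / (12 * c₁)) ^ m *
      (2 * ρ ^ k) ^ s := by gcongr
    _ = D * (((k : ℝ) + 1) ^ (d + 1) * θ ^ k) := by
      rw [hρs, hD, hθ, mul_pow, mul_pow _ _ k, div_pow, div_pow, ← pow_mul a k m,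
        ← pow_mul a m k, mul_comm m k]
      field_simp

lemma hausdorffMeasure_approxParams_eq_zero {d m : ℕ} (M : Matrix (Fin (d + 1)) (Fin m) ℝ)
    {ν s : ℝ} (hν : 0 < ν) (hM : multType M ≤ ENNReal.ofReal (((d : ℝ) + 1) / ν)) (hs0 : 0 < s)
    (hs : (d : ℝ) + 1 - ν * m < (ν + 1) * s) : μH[s] (approxParams M ν) = 0 := by
  have hcover : approxParams M ν ⊆ ⋃ B : ℕ, {x ∈ approxParams M ν | ∀ u, |x u| ≤ B} := by
    intro x hx
    obtain ⟨B, hB⟩ := exists_nat_ge ‖x‖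
    exact Set.mem_iUnion.2 ⟨B, hx, fun u => (norm_le_pi_norm x u).trans hB⟩
  refine measure_mono_null hcover (measure_iUnion_null fun B => ?_)
  set ρ : ℝ := ((2 : ℝ) ^ ν * 2)⁻¹ with hρ
  have hρ0 : 0 < ρ := by positivity
  have hρ1 : ρ < 1 := by
    have : (1 : ℝ) < 2 ^ ν := Real.one_lt_rpow (by norm_num) hν
    exact inv_lt_one_of_one_lt₀ (by linarith)
  set T : ℕ → Finset (Fin (d + 1) → ℕ) := fun k => nearIntegral M B k (fejerScale M ν k) with hT
  have hdiam : ∀ (k : ℕ) (i : Fin (d + 1) → ℕ),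
      Metric.ediam (Metric.closedBall (rationalCenter B k i) (ρ ^ k)) ≤
        ENNReal.ofReal (2 * ρ ^ k) := by
    intro k i
    refine Metric.ediam_le fun x hx y hy => ?_
    rw [edist_dist]
    apply ENNReal.ofReal_le_ofReal
    have := dist_triangle_right x y (rationalCenter B k i)
    rw [Metric.mem_closedBall] at hx hy
    linarith
  have hle := Measure.hausdorffMeasure_le_liminf_tsum (β := ℕ)
    (ι := fun n => Σ k : ℕ, {i // i ∈ T (k + n)}) s
    {x ∈ approxParams M ν | ∀ u, |x u| ≤ B} (l := Filter.atTop)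
    (fun n => ENNReal.ofReal (2 * ρ ^ n)) ?_
    (fun n ki => Metric.closedBall (rationalCenter B (ki.1 + n) ki.2.1) (ρ ^ (ki.1 + n))) ?_ ?_
  · refine le_antisymm (hle.trans ?_) zero_le
    set f : ℕ → ℝ≥0∞ := fun k => ENNReal.ofReal ((T k).card * (2 * ρ ^ k) ^ s) with hf
    have hfsum : ∑' k, f k ≠ ∞ := (summable_card_nearIntegral M hν hM hs B).tsum_ofReal_ne_top
    have htail := ENNReal.tendsto_sum_nat_add f hfsum
    rw [← htail.liminf_eq]
    refine Filter.liminf_le_liminf (Filter.Eventually.of_forall fun n => ?_)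
    rw [ENNReal.tsum_sigma']
    refine ENNReal.tsum_le_tsum fun k => ?_
    rw [tsum_fintype]
    refine (sum_le_card_nsmul _ _ (ENNReal.ofReal ((2 * ρ ^ (k + n)) ^ s)) fun i _ => ?_).trans ?_
    · rw [← ENNReal.ofReal_rpow_of_pos (by positivity)]
      exact ENNReal.rpow_le_rpow (hdiam _ _) hs0.le
    · simp only [hf]
      rw [nsmul_eq_mul, ENNReal.ofReal_mul (by positivity), ENNReal.ofReal_natCast]
      simp
  · have : Filter.Tendsto (fun n : ℕ => 2 * ρ ^ n) Filter.atTop (nhds (2 * 0)) :=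
      (tendsto_pow_atTop_nhds_zero_of_lt_one hρ0.le hρ1).const_mul 2
    simpa using ENNReal.tendsto_ofReal this
  · refine Filter.Eventually.of_forall fun n ki => (hdiam _ _).trans ?_
    apply ENNReal.ofReal_le_ofReal
    have := pow_le_pow_of_le_one hρ0.le hρ1.le (Nat.le_add_left n ki.1)
    linarith
  · refine Filter.Eventually.of_forall fun n x hx => ?_
    obtain ⟨q, ⟨hq0, h1, h2⟩, hq⟩ := hx.1.exists_gt (2 ^ n)
    have hk1 := Nat.pow_log_le_self 2 hq0.ne'
    have hk2 := Nat.lt_pow_succ_log_self (b := 2) (by norm_num) q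
    have hnk : n ≤ Nat.log 2 q := Nat.le_log_of_pow_le (by norm_num) hq.le
    obtain ⟨k, hk⟩ := Nat.exists_eq_add_of_le' hnk
    rw [hk] at hk1 hk2
    have hc := one_le_coeffBound M
    have hH : 6 * (fejerScale M ν (k + n) : ℝ) * coeffBound M ≤ ((2 : ℝ) ^ ν) ^ (k + n) := by
      have h3 : (fejerScale M ν (k + n) : ℝ) ≤ _ :=
        Nat.floor_le (by positivity : 0 ≤ ((2 : ℝ) ^ ν) ^ (k + n) / (6 * coeffBound M))
      rw [le_div_iff₀ (by positivity)] at h3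
      linarith
    obtain ⟨i, hi, hxi⟩ := exists_mem_nearIntegral M hν hH hx.2 hk1 hk2 h1 h2
    exact Set.mem_iUnion.2 ⟨⟨k, i, hi⟩, hxi⟩

lemma dimH_approxParams_le {d m : ℕ} (M : Matrix (Fin (d + 1)) (Fin m) ℝ)
    {ν : ℝ} (hν : 0 < ν) (hM : multType M ≤ ENNReal.ofReal (((d : ℝ) + 1) / ν)) :
    dimH (approxParams M ν) ≤ ENNReal.ofReal (((d : ℝ) + 1 - ν * m) / (ν + 1)) := by
  refine dimH_le fun s hs => ?_
  by_contra! hlt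
  rw [← ENNReal.ofReal_coe_nnreal] at hlt
  have hs0 : 0 < (s : ℝ) := ENNReal.ofReal_pos.1 (pos_of_gt hlt)
  have hs1 := (ENNReal.ofReal_lt_ofReal_iff hs0).1 hlt
  rw [div_lt_iff₀ (by positivity), mul_comm (s : ℝ)] at hs1
  rw [hausdorffMeasure_approxParams_eq_zero M hν hM hs0 hs1] at hs
  exact ENNReal.zero_ne_top hs

end

/-- Corollary of Theorem 3: an upper bound for the Hausdorff dimension of
`S_n(q ↦ q^{-ν}) ∩ H`, where `ℝ^n` is realized as `ℝ^d × ℝ^{n-d}` and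
`H = {(x, (1,x)·Ã) : x ∈ ℝ^d}`. -/
theorem hausdorff_dimension_upper_bound
    (n d : ℕ) (hd : 1 ≤ d) (hdn : d < n)
    (α₀ : Fin (n - d) → ℝ) (A : Matrix (Fin d) (Fin (n - d)) ℝ)
    (Atil : Matrix (Fin (d + 1)) (Fin (n - d)) ℝ)
    (hAtil : Atil = Matrix.of (Fin.cons α₀ A))
    (ν : ℝ) (hν : 1 / (n : ℝ) ≤ ν)
    (hω : multType Atil ≤ ENNReal.ofReal (((d : ℝ) + 1) / ν)) :
    dimH {p : (Fin d → ℝ) × (Fin (n - d) → ℝ) |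
      (∃ x : Fin d → ℝ, p = (x, fun v => ∑ u, (Fin.cons (1 : ℝ) x : Fin (d+1) → ℝ) u * Atil u v)) ∧
      {q : ℕ | 0 < q ∧ (∀ i, dNI ((q : ℝ) * p.1 i) < (q : ℝ) ^ (-ν)) ∧
        (∀ v, dNI ((q : ℝ) * p.2 v) < (q : ℝ) ^ (-ν))}.Infinite}
      ≤ ENNReal.ofReal ((d : ℝ) - (ν * n - 1) / (ν + 1)) := by
  have hn : (0 : ℝ) < n := by exact_mod_cast (by omega : 0 < n)
  have hν0 : 0 < ν := (by positivity : 0 < 1 / (n : ℝ)).trans_le hν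
  have hexp : ((d : ℝ) + 1 - ν * ((n - d : ℕ) : ℝ)) / (ν + 1) = d - (ν * n - 1) / (ν + 1) := by
    rw [Nat.cast_sub hdn.le]
    field_simp
    ring
  rw [← hexp]
  refine le_trans ?_ (dimH_approxParams_le Atil hν0 hω)
  have hf : ContDiff ℝ 1 fun x : Fin d → ℝ =>
      (x, fun v => ∑ u, (Fin.cons (1 : ℝ) x : Fin (d + 1) → ℝ) u * Atil u v) := by
    simp only [Fin.sum_univ_succ, Fin.cons_zero, Fin.cons_succ]
    fun_prop
  refine (dimH_mono ?_).trans
    (hf.contDiffOn.dimH_image_le convex_univ (Set.subset_univ (approxParams Atil ν)))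
  rintro p ⟨⟨x, rfl⟩, hx⟩
  exact ⟨x, hx, rfl⟩
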